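/- Let M be an n×m ungapped SNP matrix whose rows 1,...,n are ordered so that l(i) ≤ l(j) whenever i < j, augmented by two all-hole rows with indices 0 and −1. Then for all 1 ≤ i ≤ n and all h ∈ {−1,0,...,i−1} with r(h) ≤ r(i): D[h,i;i] = max over j ∈ OK(i) with j ≠ h and r(j) ≤ r(i) of the quantity which equals D[j,h;i−1] + r(i) − max{r(j), l(i)−1} when r(h) ≥ r(j), and equals D[h,j;i−1] + r(i) − max{r(j), l(i)−1} when r(h) < r(j). -/

import Mathlib

/-- A row of an SNP matrix: entries in `{0,1,-}`, where `none` is a hole. -/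
abbrev SnpRow (m : ℕ) := Fin m → Option Bool

/-- Two rows conflict if some column has opposite non-hole entries in them. -/
def Conflict {m : ℕ} (r1 r2 : SnpRow m) : Prop :=
  ∃ (p : Fin m) (b1 b2 : Bool), r1 p = some b1 ∧ r2 p = some b2 ∧ b1 ≠ b2

/-- A row is ungapped if its non-hole entries occupy a contiguous interval of columns. -/
def Ungapped {m : ℕ} (r : SnpRow m) : Prop :=
  ∀ p q s : Fin m, p ≤ q → q ≤ s → r p ≠ none → r s ≠ none → r q ≠ none

/-- `l(r)`: leftmost non-hole column (1-indexed); `0` for an all-hole row. -/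
noncomputable def lcol {m : ℕ} (r : SnpRow m) : ℕ :=
  sInf {c | ∃ p : Fin m, r p ≠ none ∧ p.val + 1 = c}

/-- `r(r)`: rightmost non-hole column (1-indexed); `0` for an all-hole row. -/
def rcol {m : ℕ} (r : SnpRow m) : ℕ :=
  (Finset.univ.filter fun p : Fin m => r p ≠ none).sup fun p => p.val + 1

/-- The length of a haplotype: its number of non-hole columns. -/
def hlen {m : ℕ} (r : SnpRow m) : ℕ :=
  (Finset.univ.filter fun p : Fin m => r p ≠ none).card

/-- The merged haplotype of a set `R` of rows of `M`: at each column, the value some row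
of `R` carries there, and a hole if all rows of `R` have a hole there. -/
def mergeRow {m : ℕ} (M : ℤ → SnpRow m) (R : Finset ℤ) : SnpRow m := fun p =>
  if ∃ i ∈ R, M i p = some true then some true
  else if ∃ i ∈ R, M i p = some false then some false
  else none

/-- A set of rows is pairwise non-conflicting. -/
def PairwiseOK {m : ℕ} (M : ℤ → SnpRow m) (R : Finset ℤ) : Prop :=
  ∀ i ∈ R, ∀ j ∈ R, ¬ Conflict (M i) (M j)

open Classical in
/-- `LHR(M)`: the maximum of `length(merge A) + length(merge B)` over disjoint,
pairwise non-conflicting sets `A, B` of rows of `M` (rows `1,…,n`). -/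
noncomputable def LHR {m : ℕ} (M : ℤ → SnpRow m) (n : ℕ) : ℕ :=
  (((Finset.Icc (1 : ℤ) n).powerset ×ˢ (Finset.Icc (1 : ℤ) n).powerset).filter fun q =>
      Disjoint q.1 q.2 ∧ PairwiseOK M q.1 ∧ PairwiseOK M q.2).sup fun q =>
    hlen (mergeRow M q.1) + hlen (mergeRow M q.2)

open Classical in
/-- `D[h,k;i]`: the maximum of `length(merge A) + length(merge B)` over disjoint,
pairwise non-conflicting sets `A, B` of rows from `{-1,0,1,…,i}` such that `k ∈ A`
maximizes `r(⬝)` in `A` and `h ∈ B` maximizes `r(⬝)` in `B`. -/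
noncomputable def Dval {m : ℕ} (M : ℤ → SnpRow m) (h k i : ℤ) : ℕ :=
  (((Finset.Icc (-1 : ℤ) i).powerset ×ˢ (Finset.Icc (-1 : ℤ) i).powerset).filter fun q =>
      Disjoint q.1 q.2 ∧ PairwiseOK M q.1 ∧ PairwiseOK M q.2 ∧
      k ∈ q.1 ∧ (∀ a ∈ q.1, rcol (M a) ≤ rcol (M k)) ∧
      h ∈ q.2 ∧ (∀ b ∈ q.2, rcol (M b) ≤ rcol (M h))).sup fun q =>
    hlen (mergeRow M q.1) + hlen (mergeRow M q.2)

open Classical in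
/-- `OK(i)`: the rows `j ∈ {-1,0,…,i-1}` that do not conflict with row `i`. -/
noncomputable def OKset {m : ℕ} (M : ℤ → SnpRow m) (i : ℤ) : Finset ℤ :=
  (Finset.Icc (-1 : ℤ) (i - 1)).filter fun j => ¬ Conflict (M j) (M i)


theorem aux_le_rcol {m : ℕ} (r : SnpRow m) (p : Fin m) (hp : r p ≠ none) :
    p.val + 1 ≤ rcol r := by
  unfold rcol
  exact Finset.le_sup (f := fun p : Fin m => p.val + 1) (by simp [hp])

theorem aux_lcol_le {m : ℕ} (r : SnpRow m) (p : Fin m) (hp : r p ≠ none) :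
    lcol r ≤ p.val + 1 := Nat.sInf_le ⟨p, hp, rfl⟩

theorem aux_rcol_le {m : ℕ} (r : SnpRow m) : rcol r ≤ m := by
  unfold rcol
  apply Finset.sup_le
  intro p _
  exact p.2

theorem aux_cov {m : ℕ} (r : SnpRow m) (hu : Ungapped r) (p : Fin m) :
    r p ≠ none ↔ lcol r ≤ p.val + 1 ∧ p.val + 1 ≤ rcol r := by
  constructor
  · intro hp
    exact ⟨aux_lcol_le r p hp, aux_le_rcol r p hp⟩
  · rintro ⟨h1, h2⟩
    have hS : ∃ s : Fin m, r s ≠ none ∧ p.val + 1 ≤ s.val + 1 := by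
      by_contra hcon
      push Not at hcon
      have : rcol r ≤ p.val := by
        unfold rcol
        apply Finset.sup_le
        intro s hs
        have := hcon s (by simpa using hs)
        omega
      omega
    obtain ⟨s, hs, hps⟩ := hS
    have hne : {c | ∃ p : Fin m, r p ≠ none ∧ p.val + 1 = c}.Nonempty := ⟨_, s, hs, rfl⟩
    obtain ⟨q, hq, hq2⟩ := Nat.sInf_mem hne
    change q.val + 1 = lcol r at hq2
    exact hu q p s (by rw [Fin.le_def]; omega) (by rw [Fin.le_def]; omega) hq hs

theorem aux_merge {m : ℕ} (M : ℤ → SnpRow m) (R : Finset ℤ) (p : Fin m) :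
    mergeRow M R p ≠ none ↔ ∃ i ∈ R, M i p ≠ none := by
  unfold mergeRow
  split_ifs with h1 h2
  · obtain ⟨i, hi, h⟩ := h1
    simp only [ne_eq, reduceCtorEq, not_false_eq_true, true_iff]
    exact ⟨i, hi, by simp [h]⟩
  · obtain ⟨i, hi, h⟩ := h2
    simp only [ne_eq, reduceCtorEq, not_false_eq_true, true_iff]
    exact ⟨i, hi, by simp [h]⟩
  · simp only [ne_eq, not_true_eq_false, false_iff]
    rintro ⟨i, hi, h⟩
    rcases hb : M i p with _ | b
    · exact h hb
    · cases b
      · exact h2 ⟨i, hi, hb⟩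
      · exact h1 ⟨i, hi, hb⟩

theorem aux_card (m c r : ℕ) (hr : r ≤ m) :
    (Finset.univ.filter fun p : Fin m => c < p.val + 1 ∧ p.val + 1 ≤ r).card = r - c := by
  rw [← Nat.card_Ioc]
  apply Finset.card_bij (fun p _ => p.val + 1)
  · intro p hp
    simpa using hp
  · intro p _ q _ h
    ext
    omega
  · intro b hb
    rw [Finset.mem_Ioc] at hb
    refine ⟨⟨b - 1, by omega⟩, ?_, ?_⟩
    · simp only [Finset.mem_filter, Finset.mem_univ, true_and]
      omega
    · simp only
      omega

theorem aux_hlen_congr {m : ℕ} (M : ℤ → SnpRow m) (R S : Finset ℤ)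
    (h : ∀ p, (∃ i ∈ R, M i p ≠ none) ↔ ∃ i ∈ S, M i p ≠ none) :
    hlen (mergeRow M R) = hlen (mergeRow M S) := by
  unfold hlen
  congr 1
  apply Finset.filter_congr
  intro p _
  rw [aux_merge, aux_merge, h]

theorem aux_insert {m : ℕ} (M : ℤ → SnpRow m) (A : Finset ℤ) (i j : ℤ)
    (hj : j ∈ A) (hmax : ∀ a ∈ A, rcol (M a) ≤ rcol (M j))
    (huj : Ungapped (M j)) (hui : Ungapped (M i)) (hl : lcol (M j) ≤ lcol (M i))
    (hr : rcol (M j) ≤ rcol (M i)) :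
    hlen (mergeRow M (insert i A)) =
      hlen (mergeRow M A) + (rcol (M i) - max (rcol (M j)) (lcol (M i) - 1)) := by
  rw [← aux_card m _ _ (aux_rcol_le (M i))]
  unfold hlen
  rw [← Finset.card_union_of_disjoint]
  · congr 1
    ext p
    simp only [Finset.mem_union, Finset.mem_filter, Finset.mem_univ, true_and, aux_merge,
      Finset.mem_insert]
    constructor
    · rintro ⟨a, rfl | ha, hp⟩
      · have h1 := (aux_cov _ hui p).1 hp
        by_cases hc : p.val + 1 ≤ rcol (M j)
        · left
          exact ⟨j, hj, (aux_cov _ huj p).2 ⟨by omega, hc⟩⟩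
        · right
          omega
      · exact Or.inl ⟨a, ha, hp⟩
    · rintro (⟨a, ha, hp⟩ | h)
      · exact ⟨a, Or.inr ha, hp⟩
      · exact ⟨i, Or.inl rfl, (aux_cov _ hui p).2 ⟨by omega, by omega⟩⟩
  · rw [Finset.disjoint_left]
    intro p hp hq
    simp only [Finset.mem_filter, Finset.mem_univ, true_and, aux_merge] at hp hq
    obtain ⟨a, ha, hap⟩ := hp
    have := aux_le_rcol _ p hap
    have := hmax a ha
    omega

def Feas {m : ℕ} (M : ℤ → SnpRow m) (h k i : ℤ) (A B : Finset ℤ) : Prop :=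
  (A ⊆ Finset.Icc (-1 : ℤ) i ∧ B ⊆ Finset.Icc (-1 : ℤ) i) ∧
  Disjoint A B ∧ PairwiseOK M A ∧ PairwiseOK M B ∧
      k ∈ A ∧ (∀ a ∈ A, rcol (M a) ≤ rcol (M k)) ∧
      h ∈ B ∧ (∀ b ∈ B, rcol (M b) ≤ rcol (M h))

theorem Feas.le {m : ℕ} {M : ℤ → SnpRow m} {h k i : ℤ} {A B : Finset ℤ}
    (H : Feas M h k i A B) : hlen (mergeRow M A) + hlen (mergeRow M B) ≤ Dval M h k i := by
  classical
  unfold Dval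
  refine Finset.le_sup (f := fun q : Finset ℤ × Finset ℤ =>
    hlen (mergeRow M q.1) + hlen (mergeRow M q.2)) (b := (A, B)) ?_
  simp only [Finset.mem_filter, Finset.mem_product, Finset.mem_powerset]
  exact H

theorem aux_D_le {m : ℕ} {M : ℤ → SnpRow m} {h k i : ℤ} {N : ℕ}
    (H : ∀ A B, Feas M h k i A B → hlen (mergeRow M A) + hlen (mergeRow M B) ≤ N) :
    Dval M h k i ≤ N := by
  classical
  unfold Dval
  apply Finset.sup_le
  rintro ⟨A, B⟩ hq
  simp only [Finset.mem_filter, Finset.mem_product, Finset.mem_powerset] at hq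
  exact H A B hq

theorem Feas.symm {m : ℕ} {M : ℤ → SnpRow m} {h k i : ℤ} {A B : Finset ℤ}
    (H : Feas M h k i A B) : Feas M k h i B A := by
  obtain ⟨⟨a, b⟩, c, d, e, f, g, x, y⟩ := H
  exact ⟨⟨b, a⟩, c.symm, e, d, x, y, f, g⟩

theorem aux_comm {m : ℕ} (M : ℤ → SnpRow m) (h k i : ℤ) : Dval M h k i = Dval M k h i := by
  apply le_antisymm
  · refine aux_D_le fun A B H => ?_
    have := H.symm.le
    omega
  · refine aux_D_le fun A B H => ?_
    have := H.symm.le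
    omega

theorem aux_self {m : ℕ} (r : SnpRow m) : ¬ Conflict r r := by
  rintro ⟨p, a, b, h1, h2, h3⟩
  rw [h1] at h2
  exact h3 (Option.some.inj h2)

theorem aux_csymm {m : ℕ} {r s : SnpRow m} (h : Conflict r s) : Conflict s r := by
  obtain ⟨p, a, b, h1, h2, h3⟩ := h
  exact ⟨p, b, a, h2, h1, h3.symm⟩

theorem aux_exists {m : ℕ} {M : ℤ → SnpRow m} {h k i : ℤ} (hhk : h ≠ k)
    (hh : h ∈ Finset.Icc (-1 : ℤ) i) (hk : k ∈ Finset.Icc (-1 : ℤ) i) :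
    ∃ A B, Feas M h k i A B ∧ Dval M h k i = hlen (mergeRow M A) + hlen (mergeRow M B) := by
  by_contra hcon
  push Not at hcon
  have H0 : Feas M h k i {k} {h} := by
    refine ⟨⟨by simpa using hk, by simpa using hh⟩, by simpa using hhk.symm, ?_, ?_, by simp,
      by simp, by simp, by simp⟩
    · intro a ha b hb
      simp only [Finset.mem_singleton] at ha hb
      subst ha; subst hb
      exact aux_self _
    · intro a ha b hb
      simp only [Finset.mem_singleton] at ha hb
      subst ha; subst hb
      exact aux_self _
  have h1 := hcon _ _ H0
  have h2 := H0.le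
  have : Dval M h k i ≤ Dval M h k i - 1 := by
    refine aux_D_le fun A B H => ?_
    have := hcon _ _ H
    have := H.le
    omega
  omega

theorem aux_hole {m : ℕ} {r : SnpRow m} (h : r = fun _ => none) :
    Ungapped r ∧ lcol r = 0 ∧ rcol r = 0 ∧ (∀ s, ¬ Conflict r s) ∧ ∀ p, r p = none := by
  subst h
  refine ⟨?_, ?_, ?_, ?_, ?_⟩
  · intro p q s _ _ hp
    exact absurd rfl hp
  · simp [lcol]
  · simp [rcol]
  · rintro s ⟨p, a, b, h1, _⟩
    simp at h1
  · simp

theorem stmt9 (n m : ℕ) (M : ℤ → SnpRow m)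
    (hug : ∀ i : ℤ, 1 ≤ i → i ≤ n → Ungapped (M i))
    (h0 : M 0 = fun _ => none) (hm1 : M (-1) = fun _ => none)
    (hord : ∀ i j : ℤ, 1 ≤ i → i < j → j ≤ n → lcol (M i) ≤ lcol (M j)) :
    ∀ i : ℤ, 1 ≤ i → i ≤ n →
      ∀ h ∈ Finset.Icc (-1 : ℤ) (i - 1), rcol (M h) ≤ rcol (M i) →
        Dval M h i i =
          ((OKset M i).filter fun j => j ≠ h ∧ rcol (M j) ≤ rcol (M i)).sup fun j =>
            (if rcol (M j) ≤ rcol (M h) then Dval M j h (i - 1) else Dval M h j (i - 1))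
              + (rcol (M i) - max (rcol (M j)) (lcol (M i) - 1)) := by
  classical
  intro i hi1 hin h hh hrh
  have hif : ∀ j, (if rcol (M j) ≤ rcol (M h) then Dval M j h (i - 1) else Dval M h j (i - 1))
      = Dval M h j (i - 1) := by
    intro j
    split_ifs
    · exact aux_comm _ _ _ _
    · rfl
  simp only [hif]
  have hui := hug i hi1 hin
  have hrow : ∀ j ∈ Finset.Icc (-1 : ℤ) (i - 1), Ungapped (M j) ∧ lcol (M j) ≤ lcol (M i) := by
    intro j hj
    rw [Finset.mem_Icc] at hj
    by_cases hj1 : 1 ≤ j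
    · exact ⟨hug j hj1 (by omega), hord j i hj1 (by omega) hin⟩
    · have : j = 0 ∨ j = -1 := by omega
      rcases this with rfl | rfl
      · have := aux_hole h0
        exact ⟨this.1, by omega⟩
      · have := aux_hole hm1
        exact ⟨this.1, by omega⟩
  have hsub : Finset.Icc (-1 : ℤ) (i - 1) ⊆ Finset.Icc (-1 : ℤ) i :=
    Finset.Icc_subset_Icc_right (by omega)
  apply le_antisymm
  · refine aux_D_le fun A B H => ?_
    obtain ⟨⟨hA, hB⟩, hd, hPA, hPB, hiA, hmA, hhB, hmB⟩ := H
    have hB' : B ⊆ Finset.Icc (-1 : ℤ) (i - 1) := by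
      intro b hb
      have h1 := hB hb
      have h2 : b ≠ i := by
        rintro rfl
        exact Finset.disjoint_left.1 hd hiA hb
      rw [Finset.mem_Icc] at h1 ⊢
      omega
    -- it suffices to find a good triple
    have key : ∀ (j : ℤ) (A' B' : Finset ℤ), Feas M h j (i - 1) A' B' → j ≠ h →
        ¬ Conflict (M j) (M i) → rcol (M j) ≤ rcol (M i) →
        hlen (mergeRow M A) = hlen (mergeRow M (insert i A')) →
        hlen (mergeRow M B) = hlen (mergeRow M B') →
        hlen (mergeRow M A) + hlen (mergeRow M B) ≤
        ((OKset M i).filter fun j => j ≠ h ∧ rcol (M j) ≤ rcol (M i)).sup fun j =>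
          Dval M h j (i - 1) + (rcol (M i) - max (rcol (M j)) (lcol (M i) - 1)) := by
      intro j A' B' HF hjh hc hr e1 e2
      have hjm := HF.1.1 HF.2.2.2.2.1
      have := aux_insert M A' i j HF.2.2.2.2.1 HF.2.2.2.2.2.1 (hrow j hjm).1 hui (hrow j hjm).2 hr
      have h3 := HF.le
      have hs : j ∈ (OKset M i).filter fun j => j ≠ h ∧ rcol (M j) ≤ rcol (M i) := by
        simp only [OKset, Finset.mem_filter]
        exact ⟨⟨hjm, hc⟩, hjh, hr⟩
      refine le_trans ?_ (Finset.le_sup (f := fun j =>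
          Dval M h j (i - 1) + (rcol (M i) - max (rcol (M j)) (lcol (M i) - 1))) hs)
      omega
    by_cases hne : (A.erase i).Nonempty
    · obtain ⟨j, hj, hjmax⟩ := Finset.exists_max_image (A.erase i) (fun a => rcol (M a)) hne
      have hjA := Finset.mem_of_mem_erase hj
      refine key j (A.erase i) B ?_ ?_ (hPA _ hjA _ hiA) (hmA _ hjA) ?_ rfl
      · refine ⟨⟨?_, hB'⟩, ?_, ?_, hPB, hj, hjmax, hhB, hmB⟩
        · intro a ha
          have h1 := hA (Finset.mem_of_mem_erase ha)
          have h2 := Finset.ne_of_mem_erase ha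
          rw [Finset.mem_Icc] at h1 ⊢
          omega
        · exact Finset.disjoint_of_subset_left (Finset.erase_subset _ _) hd
        · intro a ha b hb
          exact hPA a (Finset.mem_of_mem_erase ha) b (Finset.mem_of_mem_erase hb)
      · rintro rfl
        exact Finset.disjoint_left.1 hd hjA hhB
      · rw [Finset.insert_erase hiA]
    · have hAi : A = {i} := by
        rw [Finset.not_nonempty_iff_eq_empty] at hne
        rw [← Finset.insert_erase hiA, hne]
        rfl
      obtain ⟨j, hjh, hjm, hjn⟩ : ∃ j, j ≠ h ∧ j ∈ Finset.Icc (-1 : ℤ) (i - 1) ∧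
          M j = fun _ => none := by
        by_cases h00 : h = 0
        · exact ⟨-1, by omega, by rw [Finset.mem_Icc]; omega, hm1⟩
        · exact ⟨0, fun h => h00 h.symm, by rw [Finset.mem_Icc]; omega, h0⟩
      obtain ⟨k1, k2, k3, k4, k5⟩ := aux_hole hjn
      refine key j {j} (B.erase j) ?_ hjh (k4 _) (by omega) ?_ ?_
      · refine ⟨⟨by simpa using hjm, (Finset.erase_subset _ _).trans hB'⟩, by simp, ?_, ?_,
          by simp, by simp, Finset.mem_erase.2 ⟨hjh.symm, hhB⟩, ?_⟩
        · intro a ha b hb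
          rw [Finset.mem_singleton] at ha
          subst ha
          exact k4 _
        · intro a ha b hb
          exact hPB a (Finset.mem_of_mem_erase ha) b (Finset.mem_of_mem_erase hb)
        · intro b hb
          exact hmB b (Finset.mem_of_mem_erase hb)
      · apply aux_hlen_congr
        intro p
        simp [hAi, k5]
      · apply aux_hlen_congr
        intro p
        constructor
        · rintro ⟨a, ha, hp⟩
          refine ⟨a, Finset.mem_erase.2 ⟨?_, ha⟩, hp⟩
          rintro rfl
          exact hp (k5 p)
        · rintro ⟨a, ha, hp⟩
          exact ⟨a, Finset.mem_of_mem_erase ha, hp⟩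
  · apply Finset.sup_le
    intro j hj
    simp only [OKset, Finset.mem_filter] at hj
    obtain ⟨⟨hjm, hc⟩, hjh, hr⟩ := hj
    obtain ⟨A, B, HF, he⟩ := aux_exists (M := M) hjh.symm hh hjm
    obtain ⟨huj, hlj⟩ := hrow j hjm
    rw [he]
    obtain ⟨⟨hA, hB⟩, hd, hPA, hPB, hjA, hmA, hhB, hmB⟩ := HF
    have e := aux_insert M A i j hjA hmA huj hui hlj hr
    have hci : ∀ a ∈ A, ¬ Conflict (M a) (M i) := by
      rintro a ha ⟨p, x, y, h1, h2, h3⟩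
      have hap := aux_le_rcol (M a) p (by simp [h1])
      have hip := aux_lcol_le (M i) p (by simp [h2])
      have := hmA a ha
      have hjp := (aux_cov _ huj p).2 ⟨by omega, by omega⟩
      obtain ⟨z, hz⟩ := Option.ne_none_iff_exists'.1 hjp
      have e1 : z = y := by
        by_contra hzy
        exact hc ⟨p, z, y, hz, h2, hzy⟩
      have e2 : x = z := by
        by_contra hzy
        exact hPA a ha j hjA ⟨p, x, z, h1, hz, hzy⟩
      exact h3 (e2.trans e1)
    have HF' : Feas M h i i (insert i A) B := by
      refine ⟨⟨?_, hB.trans hsub⟩, ?_, ?_, hPB, Finset.mem_insert_self _ _, ?_, hhB, hmB⟩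
      · intro a ha
        rcases Finset.mem_insert.1 ha with rfl | ha
        · rw [Finset.mem_Icc]
          omega
        · exact hsub (hA ha)
      · rw [Finset.disjoint_insert_left]
        refine ⟨fun hiB => ?_, hd⟩
        have := hB hiB
        rw [Finset.mem_Icc] at this
        omega
      · intro a ha b hb
        rcases Finset.mem_insert.1 ha with rfl | ha2
        · rcases Finset.mem_insert.1 hb with rfl | hb
          · exact aux_self _
          · exact fun hh => hci b hb (aux_csymm hh)
        · rcases Finset.mem_insert.1 hb with rfl | hb
          · exact hci a ha2
          · exact hPA a ha2 b hb
      · intro a ha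
        rcases Finset.mem_insert.1 ha with rfl | ha
        · exact le_rfl
        · exact (hmA a ha).trans hr
    have := HF'.le
    omega
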